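/- Let σ be an absolutely continuous probability measure on ℝⁿ with finite second moment and μ a probability measure on ℝⁿ with finite second moment. Assume there exists L > 0 such that for every η ∈ S^{n-1} the one-dimensional optimal transport map T_{σ^η}^{μ^η} is L-Lipschitz on ℝ. Then for all θ, ν ∈ S^{n-1}, (∫ |T_{σ^θ}^{μ^θ}(⟨x, θ⟩) − T_{σ^ν}^{μ^ν}(⟨x, ν⟩)|² dσ(x))^{1/2} ≤ (2L + 1) C ‖θ − ν‖₂, where C = max{M₂(σ)^{1/2}, M₂(μ)^{1/2}}. -/

import Mathlib

open MeasureTheory Filter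
open scoped ENNReal RealInnerProductSpace BigOperators Topology

noncomputable section

namespace SliceMatching

/-- `ℝⁿ` with its Euclidean structure. -/
abbrev Rn (n : ℕ) := EuclideanSpace ℝ (Fin n)

/-- The cumulative distribution function of a measure on `ℝ`. -/
def cdf (ν : Measure ℝ) (t : ℝ) : ℝ := (ν (Set.Iic t)).toReal

/-- The quantile function (pseudo-inverse of the CDF) of a measure on `ℝ`. -/
def quantile (ρ : Measure ℝ) (p : ℝ) : ℝ := sInf {t : ℝ | p ≤ cdf ρ t}

/-- The one-dimensional optimal transport map `T_ν^ρ = F_ρ⁻¹ ∘ F_ν`. -/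
def otMap1d (ν ρ : Measure ℝ) (t : ℝ) : ℝ := quantile ρ (cdf ν t)

/-- The slice `σ^θ`: pushforward of `σ` under the projection `x ↦ ⟪x, θ⟫`. -/
def slice {n : ℕ} (σ : Measure (Rn n)) (θ : Rn n) : Measure ℝ :=
  σ.map (fun x => ⟪x, θ⟫)

/-- The matrix-slice matching map `T_{σ,μ;P}`, where `P ∈ O(n)` has columns `θ 0, …, θ (n-1)`:
`T_{σ,μ;P}(x) = ∑ i, T_{σ^{θ i}}^{μ^{θ i}}(⟪x, θ i⟫) • θ i`. -/
def smMap {n : ℕ} (σ μ : Measure (Rn n)) (θ : Fin n → Rn n) (x : Rn n) : Rn n :=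
  ∑ i, otMap1d (slice σ (θ i)) (slice μ (θ i)) ⟪x, θ i⟫ • θ i

/-- The squared quadratic Wasserstein distance: the infimum of `∫ ‖x - y‖²` over all
couplings of `σ` and `μ`. -/
def W2sq {α : Type*} [MeasurableSpace α] [NormedAddCommGroup α] (σ μ : Measure α) : ℝ :=
  (⨅ (π : Measure (α × α)) (_ : π.map Prod.fst = σ ∧ π.map Prod.snd = μ),
    ∫⁻ p, ENNReal.ofReal (‖p.1 - p.2‖ ^ 2) ∂π).toReal

/-- The quadratic Wasserstein distance `W₂`. -/
def W2 {α : Type*} [MeasurableSpace α] [NormedAddCommGroup α] (σ μ : Measure α) : ℝ :=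
  Real.sqrt (W2sq σ μ)
theorem cdf_eq_probabilityTheory_cdf (ρ : Measure ℝ) [IsProbabilityMeasure ρ] (t : ℝ) :
    cdf ρ t = ProbabilityTheory.cdf ρ t :=
  (ProbabilityTheory.cdf_eq_real ρ t).symm

/-- The quantile function is the lower adjoint of the CDF on the open unit interval. -/
theorem quantile_le_iff (ρ : Measure ℝ) [IsProbabilityMeasure ρ] {p : ℝ} (hp : p ∈ Set.Ioo (0 : ℝ) 1)
    (t : ℝ) : quantile ρ p ≤ t ↔ p ≤ cdf ρ t := by
  simp only [quantile, cdf_eq_probabilityTheory_cdf]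
  set F := ProbabilityTheory.cdf ρ
  set S : Set ℝ := {t | p ≤ F t}
  have hne : S.Nonempty :=
    ((ProbabilityTheory.tendsto_cdf_atTop ρ).eventually_const_le hp.2).exists
  have hbdd : BddBelow S := by
    obtain ⟨m, hm⟩ := ((ProbabilityTheory.tendsto_cdf_atBot ρ).eventually_lt_const hp.1).exists
    refine ⟨m, fun x hx => ?_⟩
    by_contra! hlt
    exact absurd (hx.trans (F.mono hlt.le)) (not_le.mpr hm)
  refine ⟨fun h => ?_, fun h => csInf_le hbdd h⟩
  have hright : Tendsto F (𝓝[>] (sInf S)) (𝓝 (F (sInf S))) :=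
    (F.right_continuous (sInf S)).mono Set.Ioi_subset_Ici_self
  refine le_trans ?_ (F.mono h)
  refine ge_of_tendsto hright ?_
  filter_upwards [self_mem_nhdsWithin] with s hs
  obtain ⟨s', hs', hlt⟩ := exists_lt_of_csInf_lt hne hs
  exact le_trans hs' (F.mono hlt.le)

theorem monotoneOn_quantile (ρ : Measure ℝ) [IsProbabilityMeasure ρ] :
    MonotoneOn (quantile ρ) (Set.Ioo 0 1) := fun _ hp _ hq hpq =>
  (quantile_le_iff ρ hp _).2 (hpq.trans ((quantile_le_iff ρ hq _).1 le_rfl))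

theorem aemeasurable_quantile (ρ : Measure ℝ) [IsProbabilityMeasure ρ] :
    AEMeasurable (quantile ρ) (volume.restrict (Set.Ioo 0 1)) :=
  aemeasurable_restrict_of_monotoneOn measurableSet_Ioo (monotoneOn_quantile ρ)

instance : IsProbabilityMeasure ((volume : Measure ℝ).restrict (Set.Ioo 0 1)) :=
  ⟨by simp⟩

/-- The quantile function pushes the uniform law on the unit interval forward to the measure. -/
theorem map_quantile (ρ : Measure ℝ) [IsProbabilityMeasure ρ] :
    (volume.restrict (Set.Ioo 0 1)).map (quantile ρ) = ρ := by
  have := Measure.isProbabilityMeasure_map (aemeasurable_quantile ρ)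
  refine Measure.ext_of_Iic _ _ fun t => ?_
  rw [Measure.map_apply_of_aemeasurable (aemeasurable_quantile ρ) measurableSet_Iic]
  have hset : quantile ρ ⁻¹' Set.Iic t ∩ Set.Ioo 0 1 = Set.Iic (cdf ρ t) ∩ Set.Ioo 0 1 := by
    ext u
    simp only [Set.mem_inter_iff, Set.mem_preimage, Set.mem_Iic]
    exact and_congr_left fun hu => quantile_le_iff ρ hu t
  have h1 : cdf ρ t ≤ 1 := by
    rw [cdf_eq_probabilityTheory_cdf]; exact ProbabilityTheory.cdf_le_one ρ t
  rw [Measure.restrict_apply₀' measurableSet_Ioo.nullMeasurableSet, hset]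
  have hlow : Set.Ioo 0 (cdf ρ t) ⊆ Set.Iic (cdf ρ t) ∩ Set.Ioo 0 1 :=
    fun u hu => ⟨hu.2.le, hu.1, hu.2.trans_le h1⟩
  have hupp : Set.Iic (cdf ρ t) ∩ Set.Ioo 0 1 ⊆ Set.Ioc 0 (cdf ρ t) :=
    fun u hu => ⟨hu.2.1, hu.1⟩
  have hF : ENNReal.ofReal (cdf ρ t) = ρ (Set.Iic t) :=
    ENNReal.ofReal_toReal (measure_ne_top _ _)
  refine le_antisymm ((measure_mono hupp).trans ?_) (le_trans ?_ (measure_mono hlow))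
  · rw [Real.volume_Ioc, sub_zero, hF]
  · rw [Real.volume_Ioo, sub_zero, hF]

theorem cdf_quantile (ρ : Measure ℝ) [IsProbabilityMeasure ρ] (hρ : ∀ t, ρ {t} = 0) {p : ℝ}
    (hp : p ∈ Set.Ioo (0 : ℝ) 1) : cdf ρ (quantile ρ p) = p := by
  refine le_antisymm ?_ ((quantile_le_iff ρ hp _).1 le_rfl)
  rw [cdf_eq_probabilityTheory_cdf]
  have hjump := (ProbabilityTheory.cdf ρ).measure_singleton (quantile ρ p)
  rw [ProbabilityTheory.measure_cdf, hρ, eq_comm, ENNReal.ofReal_eq_zero, sub_nonpos] at hjump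
  refine hjump.trans (le_of_tendsto
    ((ProbabilityTheory.monotone_cdf ρ).tendsto_leftLim (quantile ρ p)) ?_)
  filter_upwards [self_mem_nhdsWithin] with s hs
  rw [← cdf_eq_probabilityTheory_cdf]
  exact (lt_of_not_ge fun h => not_le.2 hs ((quantile_le_iff ρ hp s).2 h)).le

/-- The open triangle above the diagonal cut out by the corner `(a, b)`. -/
def triangle (a b : ℝ) : Set (ℝ × ℝ) := {p | a ≤ p.1 ∧ p.1 < p.2 ∧ p.2 < b}

theorem volume_triangle {a b : ℝ} (hab : a ≤ b) :
    volume (triangle a b) = ENNReal.ofReal ((b - a) ^ 2 / 2) := by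
  have hreg : triangle a b = regionBetween id (fun _ => b) (Set.Icc a b) := by
    ext p
    simp only [triangle, regionBetween, Set.mem_ofPred_eq, Set.mem_Icc, Set.mem_Ioo, id]
    constructor
    · rintro ⟨h1, h2, h3⟩
      exact ⟨⟨h1, (h2.trans h3).le⟩, h2, h3⟩
    · rintro ⟨⟨h1, -⟩, h2, h3⟩
      exact ⟨h1, h2, h3⟩
  rw [hreg, Measure.volume_eq_prod, volume_regionBetween_eq_integral
    (continuousOn_id.integrableOn_compact isCompact_Icc)
    (continuousOn_const.integrableOn_compact isCompact_Icc) measurableSet_Icc (fun x hx => hx.2)]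
  congr 1
  rw [integral_Icc_eq_integral_Ioc, ← intervalIntegral.integral_of_le hab]
  simp only [Pi.sub_apply, id]
  rw [intervalIntegral.integral_sub (by simp) (by simp)]
  simp
  ring

theorem triangle_eq_empty {a b : ℝ} (hab : b ≤ a) : triangle a b = ∅ :=
  Set.eq_empty_of_forall_notMem fun _ hp =>
    absurd (hp.1.trans_lt (hp.2.1.trans hp.2.2)) (not_lt.2 hab)

theorem ofReal_sub_sq_eq_volume_triangle (a b : ℝ) :
    ENNReal.ofReal ((a - b) ^ 2) = 2 * (volume (triangle a b) + volume (triangle b a)) := by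
  have key (x : ℝ) : ENNReal.ofReal (x ^ 2) = 2 * ENNReal.ofReal (x ^ 2 / 2) := by
    rw [← ENNReal.ofReal_ofNat 2, ← ENNReal.ofReal_mul (by norm_num)]
    congr 1
    ring
  rcases le_total a b with h | h
  · rw [triangle_eq_empty h, volume_triangle h, measure_empty, add_zero, ← key]
    congr 1
    ring
  · rw [triangle_eq_empty h, volume_triangle h, measure_empty, zero_add, ← key]

theorem measurableSet_triangle_graph {Ω : Type*} [MeasurableSpace Ω] {A B : Ω → ℝ}
    (hA : Measurable A) (hB : Measurable B) :
    MeasurableSet {q : Ω × (ℝ × ℝ) | q.2 ∈ triangle (A q.1) (B q.1)} := by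
  have hA' : Measurable fun q : Ω × (ℝ × ℝ) => A q.1 := by fun_prop
  have hB' : Measurable fun q : Ω × (ℝ × ℝ) => B q.1 := by fun_prop
  have hs : Measurable fun q : Ω × (ℝ × ℝ) => q.2.1 := by fun_prop
  have ht : Measurable fun q : Ω × (ℝ × ℝ) => q.2.2 := by fun_prop
  exact (measurableSet_le hA' hs).inter ((measurableSet_lt hs ht).inter (measurableSet_lt ht hB'))

theorem measurable_volume_triangle {Ω : Type*} [MeasurableSpace Ω] {A B : Ω → ℝ}
    (hA : Measurable A) (hB : Measurable B) :
    Measurable fun ω => volume (triangle (A ω) (B ω)) :=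
  measurable_measure_prodMk_left (measurableSet_triangle_graph hA hB)

theorem lintegral_volume_triangle {Ω : Type*} [MeasurableSpace Ω] (P : Measure Ω) [SFinite P]
    {A B : Ω → ℝ} (hA : Measurable A) (hB : Measurable B) :
    ∫⁻ ω, volume (triangle (A ω) (B ω)) ∂P = ∫⁻ p, P {ω | p ∈ triangle (A ω) (B ω)} := by
  have hm := measurableSet_triangle_graph hA hB
  exact (Measure.prod_apply (μ := P) (ν := volume) hm).symm.trans (Measure.prod_apply_symm hm)

theorem lintegral_sub_sq_eq {Ω : Type*} [MeasurableSpace Ω] (P : Measure Ω) [SFinite P]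
    {A B : Ω → ℝ} (hA : Measurable A) (hB : Measurable B) :
    ∫⁻ ω, ENNReal.ofReal ((A ω - B ω) ^ 2) ∂P =
      2 * ((∫⁻ p, P {ω | p ∈ triangle (A ω) (B ω)}) + ∫⁻ p, P {ω | p ∈ triangle (B ω) (A ω)}) := by
  simp_rw [ofReal_sub_sq_eq_volume_triangle]
  rw [lintegral_const_mul' _ _ (by simp), lintegral_add_left (measurable_volume_triangle hA hB),
    lintegral_volume_triangle P hA hB, lintegral_volume_triangle P hB hA]

theorem measure_quantile_triangle_le {Ω : Type*} [MeasurableSpace Ω] (P : Measure Ω)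
    [IsProbabilityMeasure P] {A B : Ω → ℝ} (hA : Measurable A) (hB : Measurable B) (p : ℝ × ℝ) :
    volume.restrict (Set.Ioo 0 1)
        {u | p ∈ triangle (quantile (P.map A) u) (quantile (P.map B) u)} ≤
      P {ω | p ∈ triangle (A ω) (B ω)} := by
  have := Measure.isProbabilityMeasure_map (μ := P) hA.aemeasurable
  have := Measure.isProbabilityMeasure_map (μ := P) hB.aemeasurable
  obtain ⟨s, t⟩ := p
  by_cases hst : s < t
  swap
  · simp [triangle, hst]
  rw [Measure.restrict_apply₀' measurableSet_Ioo.nullMeasurableSet]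
  have hsub : {u | (s, t) ∈ triangle (quantile (P.map A) u) (quantile (P.map B) u)} ∩
      Set.Ioo 0 1 ⊆ Set.Ioc (cdf (P.map B) t) (cdf (P.map A) s) := by
    rintro u ⟨⟨h1, -, h3⟩, hu⟩
    refine ⟨?_, (quantile_le_iff _ hu _).1 h1⟩
    by_contra! h
    exact absurd ((quantile_le_iff _ hu _).2 h) (not_le.2 h3)
  refine (measure_mono hsub).trans ?_
  rw [Real.volume_Ioc, cdf, cdf, ENNReal.ofReal_sub _ ENNReal.toReal_nonneg,
    ENNReal.ofReal_toReal (measure_ne_top _ _), ENNReal.ofReal_toReal (measure_ne_top _ _),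
    Measure.map_apply hA measurableSet_Iic, Measure.map_apply hB measurableSet_Iic]
  refine le_measure_sdiff.trans (measure_mono ?_)
  rintro ω ⟨h1, h2⟩
  exact ⟨h1, hst, not_le.1 h2⟩

/-- The quantile coupling of two real random variables minimises the quadratic cost. -/
theorem lintegral_quantile_sub_sq_le {Ω : Type*} [MeasurableSpace Ω] (P : Measure Ω)
    [IsProbabilityMeasure P] {A B : Ω → ℝ} (hA : Measurable A) (hB : Measurable B) :
    ∫⁻ u in Set.Ioo (0 : ℝ) 1,
        ENNReal.ofReal ((quantile (P.map A) u - quantile (P.map B) u) ^ 2) ≤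
      ∫⁻ ω, ENNReal.ofReal ((A ω - B ω) ^ 2) ∂P := by
  have := Measure.isProbabilityMeasure_map (μ := P) hA.aemeasurable
  have := Measure.isProbabilityMeasure_map (μ := P) hB.aemeasurable
  have hQA := aemeasurable_quantile (P.map A)
  have hQB := aemeasurable_quantile (P.map B)
  have hcongr : ∫⁻ u in Set.Ioo (0 : ℝ) 1,
        ENNReal.ofReal ((quantile (P.map A) u - quantile (P.map B) u) ^ 2) =
      ∫⁻ u in Set.Ioo (0 : ℝ) 1, ENNReal.ofReal ((hQA.mk _ u - hQB.mk _ u) ^ 2) := by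
    refine lintegral_congr_ae ?_
    filter_upwards [hQA.ae_eq_mk, hQB.ae_eq_mk] with u h1 h2
    rw [h1, h2]
  rw [hcongr, lintegral_sub_sq_eq _ hQA.measurable_mk hQB.measurable_mk,
    lintegral_sub_sq_eq P hA hB]
  gcongr 2 * (?_ + ?_)
  · refine lintegral_mono fun p => le_trans (measure_mono_ae ?_)
      (measure_quantile_triangle_le P hA hB p)
    filter_upwards [hQA.ae_eq_mk, hQB.ae_eq_mk] with u h1 h2 hu
    change p ∈ triangle _ _
    rw [h1, h2]
    exact hu
  · refine lintegral_mono fun p => le_trans (measure_mono_ae ?_)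
      (measure_quantile_triangle_le P hB hA p)
    filter_upwards [hQA.ae_eq_mk, hQB.ae_eq_mk] with u h1 h2 hu
    change p ∈ triangle _ _
    rw [h1, h2]
    exact hu

theorem eLpNorm_two_eq_lintegral_sq {Ω : Type*} [MeasurableSpace Ω] (P : Measure Ω) (f : Ω → ℝ) :
    eLpNorm f 2 P = (∫⁻ ω, ENNReal.ofReal (f ω ^ 2) ∂P) ^ (1 / 2 : ℝ) := by
  rw [eLpNorm_eq_lintegral_rpow_enorm_toReal (by simp) (by simp)]
  simp only [ENNReal.toReal_ofNat, ENNReal.rpow_ofNat]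
  congr 1
  refine lintegral_congr fun ω => ?_
  rw [Real.enorm_eq_ofReal_abs, ← ENNReal.ofReal_pow (abs_nonneg _), sq_abs]

theorem eLpNorm_quantile_sub_le {Ω : Type*} [MeasurableSpace Ω] (P : Measure Ω)
    [IsProbabilityMeasure P] {A B : Ω → ℝ} (hA : Measurable A) (hB : Measurable B) :
    eLpNorm (fun u => quantile (P.map A) u - quantile (P.map B) u) 2
        (volume.restrict (Set.Ioo 0 1)) ≤
      eLpNorm (fun ω => A ω - B ω) 2 P := by
  rw [eLpNorm_two_eq_lintegral_sq, eLpNorm_two_eq_lintegral_sq]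
  exact ENNReal.rpow_le_rpow (lintegral_quantile_sub_sq_le P hA hB) (by norm_num)

theorem sqrt_integral_norm_sq_eq {Ω E : Type*} [MeasurableSpace Ω] [NormedAddCommGroup E]
    {P : Measure Ω} {f : Ω → E} (hf : AEStronglyMeasurable f P) :
    Real.sqrt (∫ ω, ‖f ω‖ ^ 2 ∂P) = (eLpNorm f 2 P).toReal := by
  rw [toReal_eLpNorm hf, lpNorm_eq_integral_norm_rpow_toReal (by simp) (by simp) hf,
    Real.sqrt_eq_rpow]
  simp

section Slice

variable {n : ℕ}

instance (σ : Measure (Rn n)) [IsProbabilityMeasure σ] (θ : Rn n) :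
    IsProbabilityMeasure (slice σ θ) :=
  Measure.isProbabilityMeasure_map (by fun_prop)

theorem slice_singleton (σ : Measure (Rn n)) (hac : σ ≪ volume) {θ : Rn n} (hθ : ‖θ‖ = 1) (t : ℝ) :
    slice σ θ {t} = 0 := by
  rw [slice, Measure.map_apply (by fun_prop) (measurableSet_singleton t)]
  have hinner : ⟪θ, θ⟫ = (1 : ℝ) := by simp [hθ]
  let H : AffineSubspace ℝ (Rn n) :=
    AffineSubspace.mk' (t • θ) (LinearMap.ker (innerₛₗ ℝ θ))
  have hmem (x : Rn n) : x ∈ H ↔ ⟪x, θ⟫ = t := by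
    simp only [H, AffineSubspace.mem_mk', vsub_eq_sub, LinearMap.mem_ker, innerₛₗ_apply_apply,
      inner_sub_right, inner_smul_right, hinner, mul_one, sub_eq_zero]
    rw [real_inner_comm]
  have hH : H ≠ ⊤ := by
    intro h
    have h1 : (t + 1) • θ ∈ H := h ▸ AffineSubspace.mem_top ℝ _ _
    rw [hmem, real_inner_smul_left, hinner] at h1
    linarith
  have hset : (fun x : Rn n => ⟪x, θ⟫) ⁻¹' {t} = (H : Set (Rn n)) := by
    ext x
    exact (hmem x).symm
  rw [hset]
  exact hac (Measure.addHaar_affineSubspace volume H hH)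

theorem eLpNorm_inner_sub_inner_le (σ : Measure (Rn n)) (θ ν : Rn n) :
    eLpNorm (fun x => ⟪x, θ⟫ - ⟪x, ν⟫) 2 σ ≤ ‖θ - ν‖₊ * eLpNorm (fun x => x) 2 σ := by
  refine eLpNorm_le_nnreal_smul_eLpNorm_of_ae_le_mul (ae_of_all _ fun x => ?_) 2
  rw [← inner_sub_right, mul_comm]
  exact norm_inner_le_norm x (θ - ν)

theorem eLpNorm_comp_sub_comp_le {Ω : Type*} [MeasurableSpace Ω] (P : Measure Ω) {K : NNReal}
    {T : ℝ → ℝ} (hT : LipschitzWith K T) (f g : Ω → ℝ) :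
    eLpNorm (fun ω => T (f ω) - T (g ω)) 2 P ≤ K * eLpNorm (fun ω => f ω - g ω) 2 P := by
  refine eLpNorm_le_nnreal_smul_eLpNorm_of_ae_le_mul (ae_of_all _ fun x => ?_) 2
  exact hT.norm_sub_le (f x) (g x)

/-- The quadratic distance between two slice transport maps along the same slice. -/
theorem eLpNorm_otMap1d_sub_le (σ μ : Measure (Rn n)) [IsProbabilityMeasure σ]
    [IsProbabilityMeasure μ] (hac : σ ≪ volume) {K : NNReal} {θ ν : Rn n}
    (hθ : ‖θ‖ = 1) (hν : ‖ν‖ = 1)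
    (hTθ : LipschitzWith K (otMap1d (slice σ θ) (slice μ θ)))
    (hTν : LipschitzWith K (otMap1d (slice σ ν) (slice μ ν))) :
    eLpNorm (fun x => otMap1d (slice σ θ) (slice μ θ) ⟪x, ν⟫ -
        otMap1d (slice σ ν) (slice μ ν) ⟪x, ν⟫) 2 σ ≤
      K * eLpNorm (fun x => ⟪x, θ⟫ - ⟪x, ν⟫) 2 σ + eLpNorm (fun x => ⟪x, θ⟫ - ⟪x, ν⟫) 2 μ := by
  set Tθ := otMap1d (slice σ θ) (slice μ θ)
  set Tν := otMap1d (slice σ ν) (slice μ ν)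
  let U : Measure ℝ := volume.restrict (Set.Ioo 0 1)
  have hcont : Continuous fun t => Tθ t - Tν t := hTθ.continuous.sub hTν.continuous
  have hqθ := aemeasurable_quantile (slice σ θ)
  have hqν := aemeasurable_quantile (slice σ ν)
  have hQ := (aemeasurable_quantile (slice μ θ)).sub (aemeasurable_quantile (slice μ ν))
  have hslice : eLpNorm (fun x => Tθ ⟪x, ν⟫ - Tν ⟪x, ν⟫) 2 σ =
      eLpNorm (fun u => Tθ (quantile (slice σ ν) u) - Tν (quantile (slice σ ν) u)) 2 U := by
    have h1 := eLpNorm_map_measure (μ := σ) (p := 2) (f := fun x : Rn n => ⟪x, ν⟫)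
      hcont.aestronglyMeasurable (by fun_prop)
    have h2 := eLpNorm_map_measure (μ := U) (p := 2) (f := quantile (slice σ ν))
      hcont.aestronglyMeasurable hqν
    rw [map_quantile] at h2
    exact h1.symm.trans h2
  have hsplit : (fun u => Tθ (quantile (slice σ ν) u) - Tν (quantile (slice σ ν) u)) =ᵐ[U]
      (fun u => Tθ (quantile (slice σ ν) u) - Tθ (quantile (slice σ θ) u)) +
        fun u => quantile (slice μ θ) u - quantile (slice μ ν) u := by
    filter_upwards [ae_restrict_mem measurableSet_Ioo] with u hu
    simp only [Pi.add_apply, Tθ, Tν, otMap1d, cdf_quantile _ (slice_singleton σ hac hθ) hu,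
      cdf_quantile _ (slice_singleton σ hac hν) hu]
    ring
  rw [hslice, eLpNorm_congr_ae hsplit]
  refine (eLpNorm_add_le ?_ hQ.aestronglyMeasurable (by norm_num)).trans (add_le_add ?_ ?_)
  · exact ((hTθ.continuous.measurable.comp_aemeasurable hqν).sub
      (hTθ.continuous.measurable.comp_aemeasurable hqθ)).aestronglyMeasurable
  · refine (eLpNorm_comp_sub_comp_le U hTθ _ _).trans ?_
    gcongr
    rw [← eLpNorm_neg]
    refine le_trans (le_of_eq ?_) (eLpNorm_quantile_sub_le σ (A := fun x => ⟪x, θ⟫)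
      (B := fun x => ⟪x, ν⟫) (by fun_prop) (by fun_prop))
    congr 1
    ext u
    simp [slice]
  · exact eLpNorm_quantile_sub_le μ (by fun_prop) (by fun_prop)

end Slice

/-- Lipschitz continuity of the single-slice matching component with
respect to the slicing direction, with constant `(2L+1)·C`. -/
theorem stmt8 {n : ℕ}
    (σ μ : Measure (Rn n)) [IsProbabilityMeasure σ] [IsProbabilityMeasure μ]
    (hac : σ ≪ volume)
    (hσ2 : Integrable (fun x => ‖x‖ ^ 2) σ) (hμ2 : Integrable (fun y => ‖y‖ ^ 2) μ)
    (L : ℝ) (hL : 0 < L)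
    (hLip : ∀ η : Rn n, ‖η‖ = 1 →
      LipschitzWith (Real.toNNReal L) (otMap1d (slice σ η) (slice μ η)))
    (θ ν : Rn n) (hθ : ‖θ‖ = 1) (hν : ‖ν‖ = 1) :
    Real.sqrt (∫ x,
        |otMap1d (slice σ θ) (slice μ θ) ⟪x, θ⟫ -
          otMap1d (slice σ ν) (slice μ ν) ⟪x, ν⟫| ^ 2 ∂σ) ≤
      (2 * L + 1) *
        max (Real.sqrt (∫ x, ‖x‖ ^ 2 ∂σ)) (Real.sqrt (∫ y, ‖y‖ ^ 2 ∂μ)) *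
        ‖θ - ν‖ := by
  have hTθ := hLip θ hθ
  have hTν := hLip ν hν
  have hpair := eLpNorm_otMap1d_sub_le σ μ hac hθ hν hTθ hTν
  set Tθ := otMap1d (slice σ θ) (slice μ θ)
  set Tν := otMap1d (slice σ ν) (slice μ ν)
  have hcθ : Continuous Tθ := hTθ.continuous
  have hcν : Continuous Tν := hTν.continuous
  have hmσ : MemLp (fun x : Rn n => x) 2 σ :=
    (memLp_two_iff_integrable_sq_norm (by fun_prop)).2 hσ2
  have hmμ : MemLp (fun x : Rn n => x) 2 μ :=
    (memLp_two_iff_integrable_sq_norm (by fun_prop)).2 hμ2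
  have hmain : eLpNorm (fun x => Tθ ⟪x, θ⟫ - Tν ⟪x, ν⟫) 2 σ ≤
      2 * L.toNNReal * (‖θ - ν‖₊ * eLpNorm (fun x => x) 2 σ) +
        ‖θ - ν‖₊ * eLpNorm (fun x => x) 2 μ := by
    have hsplit : (fun x => Tθ ⟪x, θ⟫ - Tν ⟪x, ν⟫) =
        (fun x => Tθ ⟪x, θ⟫ - Tθ ⟪x, ν⟫) + fun x => Tθ ⟪x, ν⟫ - Tν ⟪x, ν⟫ := by
      ext x
      simp
    rw [hsplit]
    calc _ ≤ _ := eLpNorm_add_le (Continuous.aestronglyMeasurable (by fun_prop))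
          (Continuous.aestronglyMeasurable (by fun_prop)) (by norm_num)
      _ ≤ _ := add_le_add (eLpNorm_comp_sub_comp_le σ hTθ _ _) hpair
      _ = 2 * L.toNNReal * eLpNorm (fun x => ⟪x, θ⟫ - ⟪x, ν⟫) 2 σ +
          eLpNorm (fun x => ⟪x, θ⟫ - ⟪x, ν⟫) 2 μ := by ring
      _ ≤ _ := by
        gcongr
        · exact eLpNorm_inner_sub_inner_le σ θ ν
        · exact eLpNorm_inner_sub_inner_le μ θ ν
  have hσtop := hmσ.eLpNorm_ne_top
  have hμtop := hmμ.eLpNorm_ne_top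
  simp only [← Real.norm_eq_abs]
  rw [sqrt_integral_norm_sq_eq (Continuous.aestronglyMeasurable (by fun_prop)),
    sqrt_integral_norm_sq_eq hmσ.1, sqrt_integral_norm_sq_eq hmμ.1]
  have hreal := ENNReal.toReal_mono (by finiteness) hmain
  rw [ENNReal.toReal_add (by finiteness) (by finiteness)] at hreal
  simp only [ENNReal.toReal_mul, ENNReal.toReal_ofNat, ENNReal.coe_toReal, Real.coe_toNNReal L hL.le,
    coe_nnnorm] at hreal
  refine hreal.trans ?_
  set C := max (eLpNorm (fun x : Rn n => x) 2 σ).toReal (eLpNorm (fun x : Rn n => x) 2 μ).toReal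
  calc _ ≤ 2 * L * (‖θ - ν‖ * C) + ‖θ - ν‖ * C := by
        gcongr
        · exact le_max_left _ _
        · exact le_max_right _ _
    _ = _ := by ring

end SliceMatching
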